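/- arXiv:2109.08309 — 8 statements merged into one kernel-verified Lean document; each statement's English description precedes it below -/
import Mathlib

section
/- Convexity of MLS: Let ι be a finite type of variables, let (mem, diff) be an MLS-conjunction over ι, and let E be a nonempty finite set of pairs in ι × ι (equalities between variables). If every assignment A : ι → ZFSet that satisfies the MLS-conjunction also satisfies at least one equality from E (i.e., there exists (x,y) ∈ E with A x = A y), then there exists a single fixed pair (x,y) ∈ E such that every assignment A : ι → ZFSet satisfying the MLS-conjunction has A x = A y. -/
/-- An assignment `A` satisfies the MLS-conjunction given by the membership atoms
`mem` (atom `(x, y)` means `x ∈ y`) and the difference atoms `diff`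
(atom `(x, y, z)` means `x = y \\ z`). -/
def MLSSat {ι : Type} (mem : Finset (ι × ι)) (diff : Finset (ι × ι × ι))
    (A : ι → ZFSet) : Prop :=
  (∀ p ∈ mem, A p.1 ∈ A p.2) ∧ (∀ p ∈ diff, A p.1 = A p.2.1 \ A p.2.2)

universe u v

/-- Recursion along a well-founded relation on a type of indices, producing sets. -/
theorem ZFSet.exists_mem_iff_of_wellFounded {ι : Type} {r : ι → ι → Prop} (hr : WellFounded r)
    (T : ι → ZFSet.{u}) :
    ∃ B : ι → ZFSet.{u}, ∀ y e, e ∈ B y ↔ (∃ x, r x y ∧ B x = e) ∨ e ∈ T y := by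
  refine ⟨hr.fix fun y F => ZFSet.range (fun x : {x // r x y} => F x.1 x.2) ∪ T y, fun y e => ?_⟩
  rw [hr.fix_eq]
  simp

/-- A finite type embeds into sets in such a way that the values are nonempty and no value is an
element of another. -/
theorem ZFSet.exists_injective_nonempty_notMem (α : Type) [Finite α] :
    ∃ t : α → ZFSet.{u}, Function.Injective t ∧ (∀ a, (t a).Nonempty) ∧ ∀ a b, t a ∉ t b := by
  obtain ⟨n, hn⟩ := Countable.exists_injective_nat α
  refine ⟨fun a => {{∅, {Ordinal.toZFSet (n a)}}}, fun a b hab => hn ?_,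
    fun _ => ZFSet.singleton_nonempty _, fun a b hab => ?_⟩
  · have hab := ZFSet.singleton_injective hab
    have hmem : ({Ordinal.toZFSet (n a)} : ZFSet.{u}) ∈
        ({∅, {Ordinal.toZFSet (n b)}} : ZFSet.{u}) := by
      rw [← hab]
      simp
    rcases ZFSet.mem_pair.1 hmem with h | h
    · exact absurd (ZFSet.singleton_nonempty _) (h ▸ ZFSet.not_nonempty_empty)
    · exact_mod_cast Ordinal.toZFSet_injective (ZFSet.singleton_injective h)
  · have h := (ZFSet.singleton_eq_pair_iff.1 (ZFSet.mem_singleton.1 hab)).1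
    exact absurd (ZFSet.insert_nonempty _ _) (h ▸ ZFSet.not_nonempty_empty)

/-- The sets of variables that can occur as `{x | a ∈ A x}` for an assignment `A` satisfying the
difference atoms `diff`. -/
def MLSPlace {ι : Type} (diff : Finset (ι × ι × ι)) (σ : Set ι) : Prop :=
  ∀ p ∈ diff, p.1 ∈ σ ↔ p.2.1 ∈ σ ∧ p.2.2 ∉ σ

theorem MLSSat.place {ι : Type} {mem : Finset (ι × ι)} {diff : Finset (ι × ι × ι)}
    {A : ι → ZFSet.{v}} (hA : MLSSat mem diff A) (a : ZFSet.{v}) :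
    MLSPlace diff {x | a ∈ A x} := by
  intro p hp
  simp [hA.2 p hp]

/-- A satisfiable MLS-conjunction has a generic satisfying assignment: one that identifies two
variables only if no place separates them. -/
theorem MLSSat.exists_generic {ι : Type} [Finite ι] {mem : Finset (ι × ι)}
    {diff : Finset (ι × ι × ι)} {A : ι → ZFSet.{v}} (hA : MLSSat mem diff A) :
    ∃ B : ι → ZFSet.{u}, MLSSat mem diff B ∧
      ∀ x y, B x = B y → ∀ σ, MLSPlace diff σ → (x ∈ σ ↔ y ∈ σ) := by
  obtain ⟨t, t_inj, t_ne, t_notMem⟩ := ZFSet.exists_injective_nonempty_notMem.{u} (Set ι)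
  obtain ⟨B, hB⟩ := ZFSet.exists_mem_iff_of_wellFounded (InvImage.wf A ZFSet.mem_wf)
    fun y => ZFSet.range fun σ : {σ : Set ι // MLSPlace diff σ ∧ y ∈ σ} => t σ
  replace hB : ∀ y e, e ∈ B y ↔
      (∃ x, A x ∈ A y ∧ B x = e) ∨ ∃ σ, MLSPlace diff σ ∧ y ∈ σ ∧ t σ = e := by
    intro y e
    rw [hB]
    simp [InvImage, and_assoc]
  have t_mem_of_mem : ∀ {a x}, a ∈ A x → t {z | a ∈ A z} ∈ B x :=
    fun {a x} ha => (hB _ _).2 (.inr ⟨_, hA.place a, ha, rfl⟩)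
  have B_ne_t : ∀ x σ, B x ≠ t σ := by
    intro x σ h
    obtain ⟨e, he⟩ := t_ne σ
    rcases (hB x e).1 (h ▸ he) with ⟨w, hw, -⟩ | ⟨τ, -, -, rfl⟩
    · exact t_notMem _ σ (h ▸ t_mem_of_mem hw)
    · exact t_notMem τ σ he
  have t_mem_iff : ∀ {σ}, MLSPlace diff σ → ∀ y, t σ ∈ B y ↔ y ∈ σ := by
    intro σ hσ y
    rw [hB]
    constructor
    · rintro (⟨x, -, h⟩ | ⟨τ, -, hy, h⟩)
      · exact absurd h (B_ne_t x σ)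
      · exact t_inj h ▸ hy
    · exact fun hy => .inr ⟨σ, hσ, hy, rfl⟩
  have generic : ∀ x y, B x = B y → ∀ σ, MLSPlace diff σ → (x ∈ σ ↔ y ∈ σ) := by
    intro x y h σ hσ
    rw [← t_mem_iff hσ, ← t_mem_iff hσ, h]
  have B_mem_iff : ∀ x y, B x ∈ B y ↔ A x ∈ A y := by
    intro x y
    rw [hB]
    constructor
    · rintro (⟨w, hw, h⟩ | ⟨τ, -, -, h⟩)
      · have : A w = A x := ZFSet.ext fun a => generic w x h _ (hA.place a)
        exact this ▸ hw
      · exact absurd h.symm (B_ne_t x τ)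
    · exact fun hx => .inl ⟨x, hx, rfl⟩
  refine ⟨B, ⟨fun p hp => (B_mem_iff _ _).2 (hA.1 p hp), fun p hp => ?_⟩, generic⟩
  ext e
  rw [ZFSet.mem_sdiff]
  by_cases hw : ∃ w, B w = e
  · obtain ⟨w, rfl⟩ := hw
    simp only [B_mem_iff]
    exact hA.place (A w) p hp
  by_cases hσ : ∃ σ, MLSPlace diff σ ∧ t σ = e
  · obtain ⟨σ, hσ, rfl⟩ := hσ
    simp only [t_mem_iff hσ]
    exact hσ p hp
  have he : ∀ y, e ∉ B y := by
    intro y hy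
    rcases (hB y e).1 hy with ⟨x, -, h⟩ | ⟨σ, h, -, h'⟩
    · exact hw ⟨x, h⟩
    · exact hσ ⟨σ, h, h'⟩
  simp [he]

/-- Convexity of MLS: if every satisfying assignment of an MLS-conjunction satisfies some
equality from the nonempty finite set `E`, then some single equality of `E` is satisfied by
every satisfying assignment. -/
theorem mls_convex {ι : Type} [Fintype ι]
    (mem : Finset (ι × ι)) (diff : Finset (ι × ι × ι))
    (E : Finset (ι × ι)) (hE : E.Nonempty)
    (h : ∀ A : ι → ZFSet, MLSSat mem diff A → ∃ p ∈ E, A p.1 = A p.2) :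
    ∃ p ∈ E, ∀ A : ι → ZFSet, MLSSat mem diff A → A p.1 = A p.2 := by
  by_contra! hne
  obtain ⟨p, hp⟩ := hE
  obtain ⟨A, hA, -⟩ := hne p hp
  obtain ⟨B, hB, generic⟩ := hA.exists_generic
  obtain ⟨q, hq, hBq⟩ := h B hB
  obtain ⟨A', hA', hA'q⟩ := hne q hq
  exact hA'q (ZFSet.ext fun a => generic _ _ hBq _ (hA'.place a))
end

section
/- For every v : ι and every n ∈ ℕ, the enlarged assignment is bounded above as follows: Mₙ v ⊆ M v ∪ {s} ∪ ⋃_{k=0}^{n-1} { Mₖ u | u ∈ Vₖ ∧ M u ∈ M v }. -/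
-- The recursive enlargement construction from the convexity proof for MLS:
-- `mlsStage M N s t n = (Vₙ, Mₙ)`, where
-- `V₀ = {u | t ∈ N u}`, `Vₙ₊₁ = {u | ∃ v ∈ Vₙ, M v ∈ M u}`,
-- `M₀ u = M u ∪ {s}` if `u ∈ V₀` and `M u` otherwise, and
-- `Mₙ₊₁ u = Mₙ u ∪ {Mₙ v | v ∈ Vₙ ∧ M v ∈ M u}` if `u ∈ Vₙ₊₁` and `Mₙ u` otherwise.
open Classical in
noncomputable def mlsStage {ι : Type} [Fintype ι] (M N : ι → ZFSet) (s t : ZFSet) :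
    ℕ → Set ι × (ι → ZFSet)
  | 0 => ({u | t ∈ N u}, fun u => if t ∈ N u then M u ∪ {s} else M u)
  | n + 1 =>
      let P := mlsStage M N s t n
      ({u | ∃ v ∈ P.1, M v ∈ M u},
        fun u =>
          if ∃ v ∈ P.1, M v ∈ M u then
            P.2 u ∪ ZFSet.range (fun v : {v : ι // v ∈ P.1 ∧ M v ∈ M u} => P.2 v.1)
          else P.2 u)

/-- `Vₙ`, the set of variables modified at stage `n`. -/
noncomputable def mlsV {ι : Type} [Fintype ι] (M N : ι → ZFSet) (s t : ZFSet) (n : ℕ) :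
    Set ι :=
  (mlsStage M N s t n).1

/-- `Mₙ`, the enlarged assignment at stage `n`. -/
noncomputable def mlsM {ι : Type} [Fintype ι] (M N : ι → ZFSet) (s t : ZFSet) (n : ℕ) :
    ι → ZFSet :=
  (mlsStage M N s t n).2

/-- Upper bound on the enlarged assignments:
`Mₙ v ⊆ M v ∪ {s} ∪ ⋃_{k < n} {Mₖ u | u ∈ Vₖ ∧ M u ∈ M v}`. -/
theorem mlsM_subset_bound {ι : Type} [Fintype ι] (M N : ι → ZFSet) (s t : ZFSet) :
    ∀ (n : ℕ) (v : ι),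
      (mlsM M N s t n v).toSet ⊆
        (M v).toSet ∪ {s} ∪
          ⋃ k < n,
            {q : ZFSet | ∃ u ∈ mlsV M N s t k, M u ∈ M v ∧ q = mlsM M N s t k u} := by
  classical
  intro n
  induction n with
  | zero =>
    intro v x hx
    change x ∈ (if t ∈ N v then M v ∪ {s} else M v) at hx
    left
    split_ifs at hx
    · exact (ZFSet.mem_union.mp hx).imp_right ZFSet.mem_singleton.mp
    · exact Or.inl hx
  | succ n ih =>
    intro v x hx
    have of_stage (h : x ∈ mlsM M N s t n v) :
        x ∈ (M v).toSet ∪ {s} ∪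
          ⋃ k < n + 1,
            {q : ZFSet | ∃ u ∈ mlsV M N s t k, M u ∈ M v ∧ q = mlsM M N s t k u} := by
      refine Set.union_subset_union_right _ ?_ (ih v h)
      exact Set.biUnion_mono (fun k hk => Nat.lt_succ_of_lt hk) fun _ _ => subset_rfl
    change x ∈ (if ∃ u ∈ mlsV M N s t n, M u ∈ M v then
        mlsM M N s t n v ∪
          ZFSet.range (fun u : {u : ι // u ∈ mlsV M N s t n ∧ M u ∈ M v} => mlsM M N s t n u.1)
      else mlsM M N s t n v) at hx
    split_ifs at hx
    · rcases ZFSet.mem_union.mp hx with hx | hx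
      · exact of_stage hx
      · obtain ⟨⟨u, hu, huv⟩, rfl⟩ := ZFSet.mem_range.mp hx
        exact Or.inr (Set.mem_biUnion (Nat.lt_succ_self n) ⟨u, hu, huv, rfl⟩)
    · exact of_stage hx
end

section
/- Bound on nonempty stages: if Vₖ ≠ ∅ for some k ∈ ℕ, then k + 1 ≤ card ι and, as ordinals, (k : Ordinal) ≤ sup_{i : ι} rk(M i) (where the supremum is the finite supremum over all variables i of the ZF-rank of M i). -/
theorem natCast_le_rank_of_mem_mlsV {ι : Type} [Fintype ι] {M N : ι → ZFSet} {s t : ZFSet}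
    {k : ℕ} {u : ι} (hu : u ∈ mlsV M N s t k) : (k : Ordinal) ≤ (M u).rank := by
  induction k generalizing u with
  | zero => simp
  | succ k ih =>
    obtain ⟨v, hv, hvu⟩ := hu
    rw [Nat.cast_succ, ← Order.succ_eq_add_one]
    exact Order.succ_le_of_lt ((ih hv).trans_lt (ZFSet.rank_lt_of_mem hvu))

/-- A variable in `Vₖ` tops a membership chain, so at least `k + 1` variables have values of
rank at most that of its own value. -/
theorem exists_finset_card_rank_le_of_mem_mlsV {ι : Type} [Fintype ι] {M N : ι → ZFSet}
    {s t : ZFSet} {k : ℕ} {u : ι} (hu : u ∈ mlsV M N s t k) :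
    ∃ S : Finset ι, S.card = k + 1 ∧ ∀ i ∈ S, (M i).rank ≤ (M u).rank := by
  induction k generalizing u with
  | zero => exact ⟨{u}, by simp⟩
  | succ k ih =>
    obtain ⟨v, hv, hvu⟩ := hu
    obtain ⟨S, hS, hrank⟩ := ih hv
    have hlt := ZFSet.rank_lt_of_mem hvu
    have huS : u ∉ S := fun h => (hrank u h).not_gt hlt
    refine ⟨S.cons u huS, by rw [Finset.card_cons, hS], fun i hi => ?_⟩
    rcases Finset.mem_cons.1 hi with rfl | hi
    · exact le_rfl
    · exact (hrank i hi).trans hlt.le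

/-- Bound on nonempty stages: if `Vₖ ≠ ∅` then `k + 1 ≤ card ι` and, as ordinals,
`k ≤ sup_{i : ι} rank (M i)`. -/
theorem mlsV_nonempty_bound {ι : Type} [Fintype ι] (M N : ι → ZFSet) (s t : ZFSet)
    (k : ℕ) (hk : mlsV M N s t k ≠ ∅) :
    k + 1 ≤ Fintype.card ι ∧
      (k : Ordinal) ≤ Finset.univ.sup fun i : ι => (M i).rank := by
  obtain ⟨u, hu⟩ := Set.nonempty_iff_ne_empty.2 hk
  obtain ⟨S, hS, -⟩ := exists_finset_card_rank_le_of_mem_mlsV hu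
  exact ⟨hS ▸ S.card_le_univ, (natCast_le_rank_of_mem_mlsV hu).trans
    (Finset.le_sup (f := fun i => (M i).rank) (Finset.mem_univ u))⟩
end

section
/- Rank of the enlarged assignments: assume rk(M i) < rk(s) for every i : ι. Then for every n ∈ ℕ and v : ι: if v ∈ Vₙ then rk(Mₙ v) = rk(s) + n + 1, and if v ∉ Vₙ then rk(Mₙ v) ≤ rk(s) + n (ordinal arithmetic, with n viewed as a natural-number ordinal). -/
/-- Rank of the enlarged assignments: if `rank (M i) < rank s` for every `i`, then
`rank (Mₙ v) = rank s + n + 1` for `v ∈ Vₙ`, and `rank (Mₙ v) ≤ rank s + n` otherwise. -/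
theorem mlsM_rank {ι : Type} [Fintype ι] (M N : ι → ZFSet) (s t : ZFSet)
    (hrk : ∀ i : ι, (M i).rank < s.rank) :
    ∀ (n : ℕ) (v : ι),
      (v ∈ mlsV M N s t n → (mlsM M N s t n v).rank = s.rank + (n : Ordinal) + 1) ∧
      (v ∉ mlsV M N s t n → (mlsM M N s t n v).rank ≤ s.rank + (n : Ordinal)) := by
  intro n
  induction n with
  | zero =>
    intro v
    constructor
    · intro hv
      have hv' : t ∈ N v := hv
      simp only [mlsM, mlsStage, if_pos hv', ZFSet.rank_union, ZFSet.rank_singleton]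
      simpa using (hrk v).le.trans (Order.le_succ _)
    · intro hv
      have hv' : t ∉ N v := hv
      simpa [mlsM, mlsStage, hv'] using (hrk v).le
  | succ n ih =>
    have hle (v : ι) : (mlsM M N s t n v).rank ≤ s.rank + ((n + 1 : ℕ) : Ordinal) := by
      rw [Nat.cast_succ, ← add_assoc]
      by_cases hv : v ∈ mlsV M N s t n
      · exact ((ih v).1 hv).le
      · exact ((ih v).2 hv).trans (Order.le_succ _)
    intro u
    constructor
    · intro hu
      have hu' : ∃ v ∈ (mlsStage M N s t n).1, M v ∈ M u := hu
      simp only [mlsM, mlsStage, if_pos hu', ZFSet.rank_union]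
      obtain ⟨v, hv, hvu⟩ := hu'
      have hrank : (mlsM M N s t n v).rank = s.rank + ((n + 1 : ℕ) : Ordinal) := by
        rw [Nat.cast_succ, ← add_assoc]
        exact (ih v).1 hv
      apply le_antisymm
      · refine max_le ((hle u).trans (Order.le_succ _)) (ZFSet.rank_le_iff.2 fun y hy => ?_)
        obtain ⟨w, rfl⟩ := ZFSet.mem_range.1 hy
        exact Order.lt_succ_of_le (hle w.1)
      · refine le_max_of_le_right (Order.succ_le_of_lt ?_)
        rw [← hrank]
        exact ZFSet.rank_lt_of_mem (ZFSet.mem_range.2 ⟨⟨v, hv, hvu⟩, rfl⟩)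
    · intro hu
      have hu' : ¬ ∃ v ∈ (mlsStage M N s t n).1, M v ∈ M u := hu
      simp only [mlsM, mlsStage, if_neg hu']
      exact hle u
end

section
/- The special set s is never one of the enlarged values: assume rk(M i) < rk(s) for every i : ι. Then for every n ∈ ℕ and every v : ι, Mₙ v ≠ s. -/
open Classical in
theorem mlsM_zero {ι : Type} [Fintype ι] (M N : ι → ZFSet) (s t : ZFSet) (u : ι) :
    mlsM M N s t 0 u = if t ∈ N u then M u ∪ {s} else M u := rfl

open Classical in
theorem mlsM_succ {ι : Type} [Fintype ι] (M N : ι → ZFSet) (s t : ZFSet) (n : ℕ) (u : ι) :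
    mlsM M N s t (n + 1) u =
      if ∃ v ∈ mlsV M N s t n, M v ∈ M u then
        mlsM M N s t n u ∪ ZFSet.range
          (fun v : {v : ι // v ∈ mlsV M N s t n ∧ M v ∈ M u} => mlsM M N s t n v.1)
      else mlsM M N s t n u := rfl

/-- The variables modified at stage `n` have values of rank greater than that of `s`. -/
theorem rank_lt_rank_mlsM {ι : Type} [Fintype ι] (M N : ι → ZFSet) (s t : ZFSet) (n : ℕ) :
    ∀ u ∈ mlsV M N s t n, s.rank < (mlsM M N s t n u).rank := by
  induction n with
  | zero =>
    intro u hu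
    apply ZFSet.rank_lt_of_mem
    rw [mlsM_zero, if_pos (show t ∈ N u from hu)]
    simp
  | succ n ih =>
    intro u hu
    obtain ⟨v, hv, hvu⟩ : ∃ v ∈ mlsV M N s t n, M v ∈ M u := hu
    refine (ih v hv).trans (ZFSet.rank_lt_of_mem ?_)
    rw [mlsM_succ, if_pos ⟨v, hv, hvu⟩, ZFSet.mem_union, ZFSet.mem_range]
    exact Or.inr ⟨⟨v, hv, hvu⟩, rfl⟩

theorem rank_mlsM_ne {ι : Type} [Fintype ι] (M N : ι → ZFSet) (s t : ZFSet)
    (hrk : ∀ i : ι, (M i).rank < s.rank) (n : ℕ) (u : ι) :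
    (mlsM M N s t n u).rank ≠ s.rank := by
  by_cases hu : u ∈ mlsV M N s t n
  · exact (rank_lt_rank_mlsM M N s t n u hu).ne'
  · induction n with
    | zero =>
      rw [mlsM_zero, if_neg (show t ∉ N u from hu)]
      exact (hrk u).ne
    | succ n ih =>
      rw [mlsM_succ, if_neg (show ¬∃ v ∈ mlsV M N s t n, M v ∈ M u from hu)]
      by_cases hu' : u ∈ mlsV M N s t n
      · exact (rank_lt_rank_mlsM M N s t n u hu').ne'
      · exact ih hu'

/-- The special set `s` is never one of the enlarged values. -/
theorem mlsM_ne_special {ι : Type} [Fintype ι] (M N : ι → ZFSet) (s t : ZFSet)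
    (hrk : ∀ i : ι, (M i).rank < s.rank) :
    ∀ (n : ℕ) (v : ι), mlsM M N s t n v ≠ s :=
  fun n v h => rank_mlsM_ne M N s t hrk n v (congrArg ZFSet.rank h)
end

section
/- Low-rank elements of the enlarged assignments are old: assume rk(M i) < rk(s) for every i : ι. Then for every n ∈ ℕ, every x : ι, and every ZFC set q, if q ∈ Mₙ x and rk(q) < rk(s), then q ∈ M x. -/
/-- The enlarged value of a variable modified at stage `n` has rank at least that of `s`. -/
theorem rank_le_rank_mlsM_of_mem_mlsV {ι : Type} [Fintype ι] (M N : ι → ZFSet) (s t : ZFSet)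
    (n : ℕ) {u : ι} (hu : u ∈ mlsV M N s t n) : s.rank ≤ (mlsM M N s t n u).rank := by
  induction n generalizing u with
  | zero =>
    have hu' : t ∈ N u := hu
    refine (ZFSet.rank_lt_of_mem ?_).le
    simp [mlsM, mlsStage, hu']
  | succ n ih =>
    have hu' : ∃ v ∈ (mlsStage M N s t n).1, M v ∈ M u := hu
    obtain ⟨v, hv, hvu⟩ := id hu'
    refine (ih hv).trans (ZFSet.rank_lt_of_mem ?_).le
    simp only [mlsM, mlsStage, if_pos hu', ZFSet.mem_union, ZFSet.mem_range]
    exact Or.inr ⟨⟨v, hv, hvu⟩, rfl⟩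

/-- Low-rank elements of the enlarged assignments are old: if `q ∈ Mₙ x` and
`rank q < rank s`, then `q ∈ M x`. -/
theorem mem_of_mem_mlsM_of_rank_lt {ι : Type} [Fintype ι] (M N : ι → ZFSet) (s t : ZFSet)
    (hrk : ∀ i : ι, (M i).rank < s.rank) :
    ∀ (n : ℕ) (x : ι) (q : ZFSet),
      q ∈ mlsM M N s t n x → q.rank < s.rank → q ∈ M x := by
  intro n
  induction n with
  | zero =>
    intro x q hq hqs
    simp only [mlsM, mlsStage] at hq
    split_ifs at hq
    · rcases ZFSet.mem_union.1 hq with hq | hq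
      · exact hq
      · rw [ZFSet.mem_singleton.1 hq] at hqs
        exact absurd hqs (lt_irrefl _)
    · exact hq
  | succ n ih =>
    intro x q hq hqs
    simp only [mlsM, mlsStage] at hq
    split_ifs at hq
    · rcases ZFSet.mem_union.1 hq with hq | hq
      · exact ih x q hq hqs
      · obtain ⟨⟨v, hv, _⟩, rfl⟩ := ZFSet.mem_range.1 hq
        exact absurd hqs (rank_le_rank_mlsM_of_mem_mlsV M N s t n hv).not_gt
    · exact ih x q hq hqs
end

section
/- Non-convexity witness for MLSS (MLS with singleton): (i) for all ZFC sets x, y, x', y', x̄, x₁, x₂, x₃, if x = {y}, x' = {y'}, x̄ = x ∪ x', and x₁ ∈ x̄, x₂ ∈ x̄, x₃ ∈ x̄, then x₁ = x₂ ∨ x₁ = x₃ ∨ x₂ = x₃; (ii) for each of the three pairs (1,2), (1,3), (2,3), there exist ZFC sets x, y, x', y', x̄, x₁, x₂, x₃ satisfying all the above hypotheses such that the corresponding two sets among x₁, x₂, x₃ are distinct. -/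
theorem ZFSet.empty_ne_singleton_empty : (∅ : ZFSet) ≠ {∅} := by
  intro h
  have mem : (∅ : ZFSet) ∈ ({∅} : ZFSet) := ZFSet.mem_singleton.2 rfl
  rw [← h] at mem
  exact ZFSet.notMem_empty ∅ mem

/-- Non-convexity witness for MLSS (MLS with singleton): the conjunction
`x = {y} ∧ x' = {y'} ∧ x̄ = x ∪ x' ∧ x₁ ∈ x̄ ∧ x₂ ∈ x̄ ∧ x₃ ∈ x̄` implies the disjunction
`x₁ = x₂ ∨ x₁ = x₃ ∨ x₂ = x₃`, but implies none of the three equalities individually. -/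
theorem mlss_nonconvex :
    (∀ x y x' y' xb x₁ x₂ x₃ : ZFSet,
      x = {y} → x' = {y'} → xb = x ∪ x' → x₁ ∈ xb → x₂ ∈ xb → x₃ ∈ xb →
        x₁ = x₂ ∨ x₁ = x₃ ∨ x₂ = x₃) ∧
    (∃ x y x' y' xb x₁ x₂ x₃ : ZFSet,
      x = {y} ∧ x' = {y'} ∧ xb = x ∪ x' ∧ x₁ ∈ xb ∧ x₂ ∈ xb ∧ x₃ ∈ xb ∧ x₁ ≠ x₂) ∧
    (∃ x y x' y' xb x₁ x₂ x₃ : ZFSet,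
      x = {y} ∧ x' = {y'} ∧ xb = x ∪ x' ∧ x₁ ∈ xb ∧ x₂ ∈ xb ∧ x₃ ∈ xb ∧ x₁ ≠ x₃) ∧
    (∃ x y x' y' xb x₁ x₂ x₃ : ZFSet,
      x = {y} ∧ x' = {y'} ∧ xb = x ∪ x' ∧ x₁ ∈ xb ∧ x₂ ∈ xb ∧ x₃ ∈ xb ∧ x₂ ≠ x₃) := by
  refine ⟨?_, ?_, ?_, ?_⟩
  · rintro x y x' y' xb x₁ x₂ x₃ rfl rfl rfl h₁ h₂ h₃
    simp only [ZFSet.mem_union, ZFSet.mem_singleton] at h₁ h₂ h₃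
    grind
  · exact ⟨{∅}, ∅, {{∅}}, {∅}, {∅} ∪ {{∅}}, ∅, {∅}, ∅, rfl, rfl, rfl,
      by simp, by simp, by simp, ZFSet.empty_ne_singleton_empty⟩
  · exact ⟨{∅}, ∅, {{∅}}, {∅}, {∅} ∪ {{∅}}, ∅, ∅, {∅}, rfl, rfl, rfl,
      by simp, by simp, by simp, ZFSet.empty_ne_singleton_empty⟩
  · exact ⟨{∅}, ∅, {{∅}}, {∅}, {∅} ∪ {{∅}}, ∅, ∅, {∅}, rfl, rfl, rfl,
      by simp, by simp, by simp, ZFSet.empty_ne_singleton_empty⟩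
end

section
/- Non-convexity witness for MLSU (MLS with general union): (i) for all ZFC sets x, y, x̄, if x = ∅, ⋃₀ y = x, and ⋃₀ x̄ = y, then x̄ ⊆ {∅, {∅}}; consequently, for all x₁, x₂, x₃ ∈ x̄ one has x₁ = x₂ ∨ x₁ = x₃ ∨ x₂ = x₃; (ii) there exist ZFC sets x, y, x̄ with x = ∅, ⋃₀ y = x, ⋃₀ x̄ = y, and x̄ = {∅, {∅}}, and for each of the three pairs (1,2), (1,3), (2,3) one can choose x₁, x₂, x₃ ∈ x̄ with the corresponding two sets distinct. -/
theorem ZFSet.eq_empty_or_singleton_empty_of_sUnion_sUnion_eq_empty {a w : ZFSet}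
    (ha : ZFSet.sUnion (ZFSet.sUnion a) = ∅) (hw : w ∈ a) : w = ∅ ∨ w = {∅} := by
  have hmem : ∀ z ∈ w, z = ∅ := fun z hz => by
    refine (ZFSet.eq_empty z).2 fun u hu => ZFSet.notMem_empty u ?_
    rw [← ha]
    exact ZFSet.mem_sUnion_of_mem hu (ZFSet.mem_sUnion_of_mem hz hw)
  rcases ZFSet.eq_empty_or_nonempty w with h | ⟨z, hz⟩
  · exact Or.inl h
  · refine Or.inr (ZFSet.ext fun u => ?_)
    rw [ZFSet.mem_singleton]
    exact ⟨hmem u, fun hu => by rwa [hu, ← hmem z hz]⟩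

theorem ZFSet.sUnion_pair_empty_singleton_empty :
    ZFSet.sUnion ({∅, {∅}} : ZFSet) = {∅} := by
  ext z
  simp


/-- Non-convexity witness for MLSU (MLS with general union): from `x = ∅`, `⋃₀ y = x`,
`⋃₀ x̄ = y` it follows that `x̄ ⊆ {∅, {∅}}`, hence any three members of `x̄` contain two
equal ones; yet there is a model with `x̄ = {∅, {∅}}` in which, for each of the three
pairs, members `x₁, x₂, x₃ ∈ x̄` can be chosen with the corresponding two distinct. -/
theorem mlsu_nonconvex :
    (∀ x y xb : ZFSet, x = ∅ → ZFSet.sUnion y = x → ZFSet.sUnion xb = y →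
      xb ⊆ ({∅, {∅}} : ZFSet) ∧
        ∀ x₁ x₂ x₃ : ZFSet, x₁ ∈ xb → x₂ ∈ xb → x₃ ∈ xb →
          x₁ = x₂ ∨ x₁ = x₃ ∨ x₂ = x₃) ∧
    (∃ x y xb : ZFSet,
      x = ∅ ∧ ZFSet.sUnion y = x ∧ ZFSet.sUnion xb = y ∧ xb = ({∅, {∅}} : ZFSet) ∧
      (∃ x₁ x₂ x₃ : ZFSet, x₁ ∈ xb ∧ x₂ ∈ xb ∧ x₃ ∈ xb ∧ x₁ ≠ x₂) ∧
      (∃ x₁ x₂ x₃ : ZFSet, x₁ ∈ xb ∧ x₂ ∈ xb ∧ x₃ ∈ xb ∧ x₁ ≠ x₃) ∧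
      (∃ x₁ x₂ x₃ : ZFSet, x₁ ∈ xb ∧ x₂ ∈ xb ∧ x₃ ∈ xb ∧ x₂ ≠ x₃)) := by
  refine ⟨?_, ?_⟩
  · rintro x y xb rfl hy rfl
    have key : ∀ w ∈ xb, w = ∅ ∨ w = {∅} := fun w hw =>
      ZFSet.eq_empty_or_singleton_empty_of_sUnion_sUnion_eq_empty hy hw
    refine ⟨fun w hw => ZFSet.mem_pair.2 (key w hw), fun x₁ x₂ x₃ h₁ h₂ h₃ => ?_⟩
    rcases key x₁ h₁ with rfl | rfl <;> rcases key x₂ h₂ with rfl | rfl <;>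
      rcases key x₃ h₃ with rfl | rfl <;> simp
  · have h₀ : (∅ : ZFSet) ∈ ({∅, {∅}} : ZFSet) := ZFSet.mem_pair.2 (Or.inl rfl)
    have h₁ : ({∅} : ZFSet) ∈ ({∅, {∅}} : ZFSet) := ZFSet.mem_pair.2 (Or.inr rfl)
    have hne := ZFSet.empty_ne_singleton_empty
    exact ⟨∅, {∅}, {∅, {∅}}, rfl, ZFSet.sUnion_singleton,
      ZFSet.sUnion_pair_empty_singleton_empty, rfl,
      ⟨∅, {∅}, ∅, h₀, h₁, h₀, hne⟩, ⟨∅, ∅, {∅}, h₀, h₀, h₁, hne⟩,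
      ⟨∅, ∅, {∅}, h₀, h₀, h₁, hne⟩⟩
end
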